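/- Any MDS code over GF(q) with parameters [n, k, n-k+1] and length n ≤ q contains codewords of every weight w with n-k+1 ≤ w ≤ n; i.e., it has exactly k distinct nonzero weights. -/

import Mathlib

/-- The minimum distance (= minimum nonzero weight) of a linear code. -/
noncomputable def minDist {F : Type*} [Field F] [Fintype F] [DecidableEq F] {n : ℕ}
    (C : Submodule F (Fin n → F)) : ℕ :=
  sInf {w | ∃ c ∈ C, c ≠ 0 ∧ hammingNorm c = w}

theorem stmt_6 (q n k : ℕ) (F : Type*) [Field F] [Fintype F] [DecidableEq F]
    (hcard : Fintype.card F = q) (hn : n ≤ q)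
    (C : Submodule F (Fin n → F)) (hk : Module.finrank F C = k)
    (hd : minDist C = n - k + 1) :
    (∀ w : ℕ, n - k + 1 ≤ w → w ≤ n → ∃ c ∈ C, hammingNorm c = w) ∧
    {w : ℕ | w ≠ 0 ∧ ∃ c ∈ C, hammingNorm c = w}.ncard = k := by
  have hkn : k ≤ n := by
    have h := Submodule.finrank_le C
    rw [hk] at h
    simpa using h
  have hmin : ∀ c ∈ C, c ≠ 0 → n - k + 1 ≤ hammingNorm c := by
    intro c hc h0
    rw [← hd]
    exact Nat.sInf_le ⟨c, hc, h0, rfl⟩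
  have hne : {w | ∃ c ∈ C, c ≠ 0 ∧ hammingNorm c = w}.Nonempty := by
    by_contra h
    rw [Set.not_nonempty_iff_eq_empty] at h
    unfold minDist at hd
    rw [h] at hd
    simp at hd
  have hstart : ∃ c ∈ C, hammingNorm c = n - k + 1 := by
    obtain ⟨c, hc, _, h⟩ := Nat.sInf_mem hne
    exact ⟨c, hc, h.trans hd⟩
  have hle : ∀ c : Fin n → F, hammingNorm c ≤ n := by
    intro c
    simpa using hammingNorm_le_card_fintype (x := c)
  have hcompl : ∀ c : Fin n → F, (Finset.univ.filter fun j => c j = 0).card + hammingNorm c = n := by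
    intro c
    have := Finset.card_filter_add_card_filter_not (s := (Finset.univ : Finset (Fin n)))
      (fun j => c j = 0)
    simpa [hammingNorm] using this
  have hinfo : ∀ I : Finset (Fin n), I.card = k → ∀ i ∈ I,
      ∃ b ∈ C, b i = 1 ∧ ∀ j ∈ I, j ≠ i → b j = 0 := by
    intro I hI i hi
    let φ : C →ₗ[F] (I → F) :=
      (LinearMap.funLeft F F (Subtype.val : I → Fin n)).comp C.subtype
    have hφ : ∀ (x : C) (j : I), φ x j = (x : Fin n → F) j := fun x j => rfl
    have hinj : Function.Injective φ := by
      rw [← LinearMap.ker_eq_bot, LinearMap.ker_eq_bot']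
      intro x hx
      by_contra h0
      have h1 := hmin x x.2 (by simpa using h0)
      have h2 := hcompl x
      have h3 : I.card ≤ (Finset.univ.filter fun j => (x : Fin n → F) j = 0).card := by
        apply Finset.card_le_card
        intro j hj
        have := congrFun hx ⟨j, hj⟩
        rw [hφ] at this
        simpa using this
      omega
    have hsurj : Function.Surjective φ :=
      (LinearMap.injective_iff_surjective_of_finrank_eq_finrank (by simp [hk, hI])).1 hinj
    obtain ⟨x, hx⟩ := hsurj (Pi.single ⟨i, hi⟩ 1)
    refine ⟨x, x.2, ?_, ?_⟩
    · rw [← hφ x ⟨i, hi⟩, hx]; simp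
    · intro j hj hji
      rw [← hφ x ⟨j, hj⟩, hx, Pi.single_eq_of_ne]
      simpa using hji
  have hall : ∀ w : ℕ, n - k + 1 ≤ w → w ≤ n → ∃ c ∈ C, hammingNorm c = w := by
    intro w hw
    induction w, hw using Nat.le_induction with
    | base => intro _; exact hstart
    | succ w hw ih =>
      intro hwn
      obtain ⟨c, hc, hcw⟩ := ih (by omega)
      set Z := Finset.univ.filter fun j => c j = 0 with hZ
      have hZc : Z.card + w = n := by rw [← hcw]; exact hcompl c
      obtain ⟨i, hi⟩ : Z.Nonempty := Finset.card_pos.1 (by omega)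
      obtain ⟨I, hZI, hI⟩ := Finset.exists_superset_card_eq (s := Z) (n := k)
        (by omega) (by simpa using hkn)
      obtain ⟨b, hb, hbi, hb0⟩ := hinfo I hI i (hZI hi)
      obtain ⟨l, hl⟩ : ∃ l : F, l ∉ (Finset.univ.filter fun j => c j ≠ 0).image
          (fun j => - b j / c j) := by
        by_contra! h
        have h1 : Fintype.card F ≤ _ := Finset.card_le_card (fun x _ => h x)
        have h2 := h1.trans Finset.card_image_le
        change _ ≤ hammingNorm c at h2
        omega
      refine ⟨b + l • c, C.add_mem hb (C.smul_mem l hc), ?_⟩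
      have h4 := hcompl (b + l • c)
      have h5 : (Finset.univ.filter fun j => (b + l • c) j = 0) = Z.erase i := by
        ext j
        simp only [Finset.mem_filter, Finset.mem_univ, true_and, Finset.mem_erase, hZ,
          Pi.add_apply, Pi.smul_apply, smul_eq_mul]
        constructor
        · intro h
          have hcj : c j = 0 := by
            by_contra hcj
            apply hl
            refine Finset.mem_image.2 ⟨j, by simpa using hcj, ?_⟩
            rw [div_eq_iff hcj]
            linear_combination -h
          refine ⟨?_, hcj⟩
          rintro rfl
          simp [hcj, hbi] at h
        · rintro ⟨hji, hcj⟩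
          rw [hb0 j (hZI (by simpa [hZ] using hcj)) hji, hcj]
          simp
      rw [h5, Finset.card_erase_of_mem hi] at h4
      omega
  refine ⟨hall, ?_⟩
  have hset : {w : ℕ | w ≠ 0 ∧ ∃ c ∈ C, hammingNorm c = w} =
      ((Finset.Icc (n - k + 1) n : Finset ℕ) : Set ℕ) := by
    ext w
    simp only [Set.mem_setOf_eq, Finset.coe_Icc, Set.mem_Icc]
    constructor
    · rintro ⟨h0, c, hc, rfl⟩
      exact ⟨hmin c hc (hammingNorm_ne_zero_iff.1 h0), hle c⟩
    · rintro ⟨h1, h2⟩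
      exact ⟨by omega, hall w h1 h2⟩
  rw [hset, Set.ncard_coe_finset, Nat.card_Icc]
  omega
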